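/- In the real vector space of functions from {a,b}* to ℝ, the family of functions (g_i)_{i∈ℕ} defined by g_i(v) = L_a(aⁱ b v) (the language L_a shifted by the word aⁱb) is linearly independent. -/

import Mathlib

/-- The two-letter alphabet `{a, b}`. -/
inductive AB : Type
  | a : AB
  | b : AB
deriving DecidableEq

/-- `maxRunAux u cur m` computes the maximum of `m` and of the lengths of all blocks of
consecutive `a`'s in `u`, where the word is preceded by a run of `cur` letters `a`. -/
def maxRunAux : List AB → ℕ → ℕ → ℕ
  | [], cur, m => max cur m
  | AB.a :: u, cur, m => maxRunAux u (cur + 1) m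
  | AB.b :: u, cur, m => maxRunAux u 0 (max cur m)

/-- The length of the longest block of consecutive `a`'s in a word. -/
def maxRun (u : List AB) : ℕ := maxRunAux u 0 0

/-- The weighted language `L_a(u) = 2^(−maxRun u)`. -/
noncomputable def La (u : List AB) : ℝ := (2 : ℝ) ^ (-(maxRun u : ℤ))

theorem maxRunAux_replicate_append (i : ℕ) (u : List AB) (cur m : ℕ) :
    maxRunAux (List.replicate i AB.a ++ u) cur m = maxRunAux u (cur + i) m := by
  induction i generalizing cur with
  | zero => simp
  | succ i ih =>
    rw [List.replicate_succ, List.cons_append, maxRunAux, ih]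
    congr 1
    omega

theorem maxRun_replicate_b_replicate (i j : ℕ) :
    maxRun (List.replicate i AB.a ++ AB.b :: List.replicate j AB.a) = max i j := by
  rw [maxRun, maxRunAux_replicate_append, maxRunAux, ← List.append_nil (List.replicate j AB.a),
    maxRunAux_replicate_append, maxRunAux]
  omega

/-- The scaled difference of `g_i` at `a^j` and `a^(j+1)` is the indicator of `i ≤ j`. -/
theorem two_pow_mul_La_sub_La (i j : ℕ) :
    (2 : ℝ) ^ (j + 1) * (La (List.replicate i AB.a ++ AB.b :: List.replicate j AB.a) -
      La (List.replicate i AB.a ++ AB.b :: List.replicate (j + 1) AB.a)) =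
      if i ≤ j then 1 else 0 := by
  simp only [La, maxRun_replicate_b_replicate, zpow_neg, zpow_natCast]
  split_ifs with hij
  · rw [max_eq_right hij, max_eq_right (by omega : i ≤ j + 1)]
    field_simp
    ring
  · rw [max_eq_left (by omega : j ≤ i), max_eq_left (by omega : j + 1 ≤ i)]
    ring

/-- In the real vector space of functions `{a,b}* → ℝ`, the family of shifted languages
`g_i(v) = L_a(aⁱ b v)` is linearly independent. -/
theorem stmt5 :
    LinearIndependent ℝ
      (fun i : ℕ => fun v : List AB => La (List.replicate i AB.a ++ AB.b :: v)) := by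
  rw [linearIndependent_iff']
  intro s c hc
  have eval_eq (v : List AB) :
      ∑ i ∈ s, c i * La (List.replicate i AB.a ++ AB.b :: v) = 0 := by
    simpa [Finset.sum_apply] using congrFun hc v
  have partial_sum (j : ℕ) : ∑ i ∈ s, c i * (if i ≤ j then 1 else 0) = 0 := by
    simp only [← two_pow_mul_La_sub_La, mul_left_comm (c _), ← Finset.mul_sum, mul_sub,
      Finset.sum_sub_distrib, eval_eq, mul_zero, sub_zero]
  intro j
  induction j using Nat.strong_induction_on with
  | _ j ih =>
    intro hj
    have h := partial_sum j
    rw [Finset.sum_eq_single_of_mem j hj] at h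
    · simpa using h
    · intro i hi hij
      rcases lt_or_gt_of_ne hij with hlt | hgt
      · simp [ih i hlt hi]
      · simp [not_le.mpr hgt]
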